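/- Let 0 < γ < 2, a > 0, and let R: V → ℝ be a solution of the radii system with R(z) > 0 for all z ∈ V and initial values R(0)=1, R(i) = a·tan(γπ/4). Then for every integer N ≥ 1: R(−N+1+iN)·R(−N+i(N+1)) = R(−N+iN)², and symmetrically R(N−1+iN)·R(N+i(N+1)) = R(N+iN)². (That is, R also satisfies equation (Ri) at the diagonal points z = ±N+iN.) -/

import Mathlib

open Real
/-- Membership of `z = N + i M` in the quadrant `V = {N + iM : M ≥ |N|}`. -/
def inV (N M : ℤ) : Prop := |N| ≤ M

/-- Membership of `z = N + i M` in the interior part `V_int = {N + iM : M > |N|}`. -/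
def inVint (N M : ℤ) : Prop := |N| < M

/-- Equation (square) at `z = N + i M`  (here `z + 1` shifts `N`, `z + i` shifts `M`). -/
def SquareEq (γ : ℝ) (R : ℤ → ℤ → ℝ) (N M : ℤ) : Prop :=
  R N M * R (N + 1) M * (-2 * (M : ℝ) - γ) +
    R (N + 1) M * R (N + 1) (M + 1) * (2 * ((N : ℝ) + 1) - γ) +
    R (N + 1) (M + 1) * R N (M + 1) * (2 * ((M : ℝ) + 1) - γ) +
    R N (M + 1) * R N M * (-2 * (N : ℝ) - γ) = 0

/-- Equation (Ri) at `z = N + i M`. -/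
def RiEq (R : ℤ → ℤ → ℝ) (N M : ℤ) : Prop :=
  ((N : ℝ) + M) * (R N M ^ 2 - R (N + 1) M * R N (M - 1)) * (R N (M + 1) + R (N + 1) M) +
    ((M : ℝ) - N) * (R N M ^ 2 - R N (M + 1) * R (N + 1) M) * (R (N + 1) M + R N (M - 1)) = 0

/-- `R : V → ℝ` is a solution of the radii system: (square) holds whenever all four
corners lie in `V`, (recR) holds on both diagonals, and (Ri) holds on `V_int`. -/
def IsRadiiSolution (γ : ℝ) (R : ℤ → ℤ → ℝ) : Prop :=
  (∀ N M : ℤ, inV N M → inV (N + 1) M → inV N (M + 1) → inV (N + 1) (M + 1) →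
      SquareEq γ R N M) ∧
  (∀ N : ℕ, R ((N : ℤ) + 1) ((N : ℤ) + 1) =
        ((2 * (N : ℝ) + γ) / (2 * ((N : ℝ) + 1) - γ)) * R (N : ℤ) (N : ℤ) ∧
      R (-((N : ℤ) + 1)) ((N : ℤ) + 1) =
        ((2 * (N : ℝ) + γ) / (2 * ((N : ℝ) + 1) - γ)) * R (-(N : ℤ)) (N : ℤ)) ∧
  (∀ N M : ℤ, inVint N M → RiEq R N M)


lemma left_step {n γ P E B C D A : ℝ} (hn : 0 ≤ n) (hγ0 : 0 < γ) (hγ2 : γ < 2)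
    (hP : 0 < P) (hE : 0 < E) (hB : 0 < B) (hC : 0 < C) (hA0 : 0 < A)
    (hA : A * (2*n+2-γ) = (2*n+γ)*P)
    (hS : E*((2-2*n-γ)*P^2+(2*n+2-γ)*B^2) = P*((2*n+γ)*P^2-(2*n-γ)*B^2))
    (hR : (B^2-E*P)*(C+E)+(2*n+1)*(B^2-C*E)*(E+P) = 0)
    (hQ : A*B*(-2*n-2-γ)+B*C*(-2*n-γ)+C*D*(2*n+4-γ)+D*A*(2*n+2-γ) = 0) :
    B * D = A^2 := by
  have hq : 0 < 2*n+γ := by linarith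
  have hr : 0 < 2*n+2-γ := by linarith
  have hr' : 0 < 2*n+4-γ := by linarith
  have hX : B^2 - E*P - (2*n+1)*E*(E+P) ≠ 0 := by
    intro h
    have h2 : B^2*E - E^2*P + (2*n+1)*B^2*(E+P) = 0 := by linear_combination hR - C*h
    have h3 : B^2 = E*P + (2*n+1)*E*(E+P) := by linarith
    rw [h3] at h2
    have : (E*P + (2*n+1)*E*(E+P))*E - E^2*P + (2*n+1)*(E*P + (2*n+1)*E*(E+P))*(E+P)
      = (2*n+1)*E*(E+P)*E + (2*n+1)*(E*P + (2*n+1)*E*(E+P))*(E+P) := by ring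
    rw [this] at h2
    have : 0 < (2*n+1)*E*(E+P)*E + (2*n+1)*(E*P + (2*n+1)*E*(E+P))*(E+P) := by positivity
    linarith
  have hG : C*((2*n+γ)*(2*n+4-γ)*P^2-(2*n+2-γ)^2*B^2)
      + P*((2*n+γ)^2*P^2-(2*n+2-γ)*(2*n+γ+2)*B^2) = 0 := by
    apply (mul_eq_zero.mp _).resolve_left hX
    linear_combination ((2*n+γ)*(2*n+4-γ)*P^2-(2*n+2-γ)^2*B^2) * hR
      + (2*n+2)*((2*n+γ)*E*P+(2*n+2-γ)*B^2) * hS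
  have hK : 0 < C*(2*n+4-γ)+A*(2*n+2-γ) := by positivity
  have h5 : (B*D-A^2) * (C*(2*n+4-γ)+A*(2*n+2-γ)) = 0 := by
    have : (B*D-A^2) * (C*(2*n+4-γ)+A*(2*n+2-γ)) =
      B^2*(A*(2*n+γ+2)+C*(2*n+γ)) - A^2*(C*(2*n+4-γ)+A*(2*n+2-γ)) := by
      linear_combination B * hQ
    rw [this]
    have hr2 : (2*n+2-γ)^2 ≠ 0 := by positivity
    apply (mul_eq_zero.mp _).resolve_left hr2
    have e2 : (A * (2*n+2-γ))^2 = ((2*n+γ)*P)^2 := by rw [hA]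
    have e3 : (A * (2*n+2-γ))^3 = ((2*n+γ)*P)^3 := by rw [hA]
    linear_combination (-(2*n+γ)) * hG + B^2*(2*n+2-γ)*(2*n+γ+2)*hA - C*(2*n+4-γ)*e2 - e3
  rcases mul_eq_zero.mp h5 with h | h <;> linarith

lemma right_step {n γ P E B C D : ℝ} (hn : 0 ≤ n) (hγ0 : 0 < γ) (hγ2 : γ < 2)
    (hE : 0 < E) (hB : 0 < B) (hC : 0 < C)
    (hA : E * (2*n+2-γ) = (2*n+γ)*P)
    (hR : (2*n+1)*(B^2-E*P)*(C+E)+(B^2-C*E)*(E+P) = 0)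
    (hQ : B*E*(-2*n-2-γ)+E*D*(2*n+2-γ)+D*C*(2*n+4-γ)+C*B*(-2*n-γ) = 0) :
    B * D = E^2 := by
  have hq : 0 < 2*n+γ := by linarith
  have hr : 0 < 2*n+2-γ := by linarith
  have hr' : 0 < 2*n+4-γ := by linarith
  have hPe : P = E * (2*n+2-γ) / (2*n+γ) := by field_simp; linarith
  have hG : C*((2*n+γ)*B^2-(2*n+4-γ)*E^2)+E*((2*n+2+γ)*B^2-(2*n+2-γ)*E^2) = 0 := by
    rw [hPe] at hR
    field_simp at hR
    have h1 : (2*n+1) ≠ 0 := by linarith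
    apply (mul_eq_zero.mp _).resolve_left h1
    linear_combination hR
  have hK : 0 < C*(2*n+4-γ)+E*(2*n+2-γ) := by positivity
  have h5 : (B*D-E^2) * (C*(2*n+4-γ)+E*(2*n+2-γ)) = 0 := by
    linear_combination B * hQ + hG
  rcases mul_eq_zero.mp h5 with h | h <;> linarith

lemma left_all {γ : ℝ} (hγ0 : 0 < γ) (hγ2 : γ < 2)
    {R : ℤ → ℤ → ℝ} (hsol : IsRadiiSolution γ R)
    (hpos : ∀ N M : ℤ, inV N M → 0 < R N M) (n : ℕ) :
    R (-(n:ℤ)) (n+1) * R (-(n:ℤ)-1) (n+2) = R (-(n:ℤ)-1) (n+1) ^ 2 := by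
  obtain ⟨hsq, hrec, hri⟩ := hsol
  have step : ∀ n : ℕ, R (-(n:ℤ)+1) (n+1)*((2-2*n-γ)*R (-(n:ℤ)) n^2+(2*n+2-γ)*R (-(n:ℤ)) (n+1)^2)
      = R (-(n:ℤ)) n*((2*n+γ)*R (-(n:ℤ)) n^2-(2*n-γ)*R (-(n:ℤ)) (n+1)^2) →
      R (-(n:ℤ)) (n+1) * R (-(n:ℤ)-1) (n+2) = R (-(n:ℤ)-1) (n+1) ^ 2 := by
    intro n hS
    have hn : (0:ℝ) ≤ n := n.cast_nonneg
    have p : ∀ N M : ℤ, |N| ≤ M → 0 < R N M := hpos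
    refine left_step (n := n) (γ := γ) (P := R (-(n:ℤ)) n) (E := R (-(n:ℤ)+1) (n+1))
      (C := R (-(n:ℤ)) (n+2)) hn hγ0 hγ2 ?_ ?_ ?_ ?_ ?_ ?_ hS ?_ ?_
    · exact p _ _ (by rw [abs_le]; omega)
    · exact p _ _ (by rw [abs_le]; omega)
    · exact p _ _ (by rw [abs_le]; omega)
    · exact p _ _ (by rw [abs_le]; omega)
    · exact p _ _ (by rw [abs_le]; omega)
    · have h := (hrec n).2
      have hr : 2*((n:ℝ)+1)-γ ≠ 0 := by linarith
      rw [show -(n:ℤ)-1 = -((n:ℤ)+1) by ring, h]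
      field_simp
    · have h := hri (-(n:ℤ)) (n+1) (by unfold inVint; rw [abs_lt]; omega)
      unfold RiEq at h
      rw [show (n:ℤ)+1+1 = n+2 by ring, show (n:ℤ)+1-1 = n by ring] at h
      push_cast at h
      linear_combination h
    · have h := hsq (-(n:ℤ)-1) (n+1) (by unfold inV; rw [abs_le]; omega)
        (by unfold inV; rw [abs_le]; omega) (by unfold inV; rw [abs_le]; omega)
        (by unfold inV; rw [abs_le]; omega)
      unfold SquareEq at h
      rw [show (n:ℤ)+1+1 = n+2 by ring, show -(n:ℤ)-1+1 = -n by ring] at h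
      push_cast at h
      linear_combination h
  induction n with
  | zero =>
    apply step
    have h := (hrec 0).1
    have hr : 2-γ ≠ 0 := by linarith
    simp at h ⊢
    rw [h]
    field_simp
  | succ n ih =>
    apply step
    have h := hsq (-(n:ℤ)-1) (n+1) (by unfold inV; rw [abs_le]; omega)
        (by unfold inV; rw [abs_le]; omega) (by unfold inV; rw [abs_le]; omega)
        (by unfold inV; rw [abs_le]; omega)
    have hB : 0 < R (-(n:ℤ)-1) (n+2) := hpos _ _ (by unfold inV; rw [abs_le]; omega)
    unfold SquareEq at h
    rw [show (n:ℤ)+1+1 = n+2 by ring, show -(n:ℤ)-1+1 = -n by ring] at h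
    push_cast at h ⊢
    rw [show (n:ℤ)+1+1 = n+2 by ring, show -((n:ℤ)+1)+1 = -n by ring,
      show -((n:ℤ)+1) = -n-1 by ring]
    linear_combination R (-(n:ℤ)-1) (n+2) * h +
      ((2*(n:ℝ)+2+γ) * R (-(n:ℤ)-1) (n+1) + (2*(n:ℝ)+γ) * R (-(n:ℤ)) (n+2)) * ih

/-- a positive solution of the radii system with initial values
`R(0) = 1`, `R(i) = a·tan(γπ/4)` also satisfies (Ri) at the diagonal points. -/
theorem stmt9 (γ : ℝ) (hγ0 : 0 < γ) (hγ2 : γ < 2) (a : ℝ) (ha : 0 < a)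
    (R : ℤ → ℤ → ℝ) (hsol : IsRadiiSolution γ R)
    (hpos : ∀ N M : ℤ, inV N M → 0 < R N M)
    (h0 : R 0 0 = 1) (hi : R 0 1 = a * Real.tan (γ * Real.pi / 4)) :
    ∀ N : ℤ, 1 ≤ N →
      R (-N + 1) N * R (-N) (N + 1) = R (-N) N ^ 2 ∧
      R (N - 1) N * R N (N + 1) = R N N ^ 2 := by
  intro N hN
  obtain ⟨n, rfl⟩ : ∃ n : ℕ, N = n + 1 := ⟨(N-1).toNat, by omega⟩
  constructor
  · have h := left_all hγ0 hγ2 hsol hpos n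
    rw [show -((n:ℤ)+1)+1 = -n by ring, show (n:ℤ)+1+1 = n+2 by ring,
      show -((n:ℤ)+1) = -n-1 by ring]
    exact h
  · obtain ⟨hsq, hrec, hri⟩ := hsol
    have hn : (0:ℝ) ≤ n := n.cast_nonneg
    have p : ∀ N M : ℤ, |N| ≤ M → 0 < R N M := hpos
    rw [show (n:ℤ)+1-1 = n by ring, show (n:ℤ)+1+1 = n+2 by ring]
    refine right_step (n := n) (γ := γ) (P := R n n) (C := R n (n+2)) hn hγ0 hγ2 ?_ ?_ ?_ ?_ ?_ ?_
    · exact p _ _ (by rw [abs_le]; omega)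
    · exact p _ _ (by rw [abs_le]; omega)
    · exact p _ _ (by rw [abs_le]; omega)
    · have h := (hrec n).1
      have hr : 2*((n:ℝ)+1)-γ ≠ 0 := by linarith
      rw [h]
      field_simp
    · have h := hri n (n+1) (by unfold inVint; rw [abs_lt]; omega)
      unfold RiEq at h
      rw [show (n:ℤ)+1+1 = n+2 by ring, show (n:ℤ)+1-1 = n by ring] at h
      push_cast at h
      linear_combination h
    · have h := hsq n (n+1) (by unfold inV; rw [abs_le]; omega)
        (by unfold inV; rw [abs_le]; omega) (by unfold inV; rw [abs_le]; omega)
        (by unfold inV; rw [abs_le]; omega)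
      unfold SquareEq at h
      rw [show (n:ℤ)+1+1 = n+2 by ring] at h
      push_cast at h
      linear_combination h
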